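/- arXiv:1411.3575 — 3 statements merged into one kernel-verified Lean document; each statement's English description precedes it below -/
import Mathlib

section
/- Let Φ : [0,∞) → ℝ be convex with Φ(0) finite, such that Ψ(u) = (Φ(u) − Φ(0))/u is concave on (0,∞) and the Φ-entropy is homogeneous. Let (μ,K) be an admissible pair on finite alphabets with η_Φ(μ,K) ≤ c for some c < 1, and let (X,Y) ~ μ⊗K. Then for every strictly positive f : X → (0,∞): Ent_Φ[f(X)] ≤ (1/(1−c))·ℰ(f(X), Ψ∘f(X) | Y). -/
open Finset

noncomputable section

namespace SDPI

variable {X Y : Type} [Fintype X] [Fintype Y]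

def IsDist (μ : X → ℝ) : Prop := (∀ x, 0 ≤ μ x) ∧ ∑ x, μ x = 1

def IsPosDist (μ : X → ℝ) : Prop := (∀ x, 0 < μ x) ∧ ∑ x, μ x = 1

def IsChannel (K : X → Y → ℝ) : Prop :=
  (∀ x y, 0 ≤ K x y) ∧ ∀ x, ∑ y, K x y = 1

def push (μ : X → ℝ) (K : X → Y → ℝ) : Y → ℝ := fun y => ∑ x, μ x * K x y

def fDiv (Φ : ℝ → ℝ) (ν μ : X → ℝ) : ℝ := (∑ x, μ x * Φ (ν x / μ x)) - Φ 1

def eta (Φ : ℝ → ℝ) (μ : X → ℝ) (K : X → Y → ℝ) : ℝ :=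
  sSup { r | ∃ ν : X → ℝ, IsDist ν ∧ ν ≠ μ ∧
    r = fDiv Φ (push ν K) (push μ K) / fDiv Φ ν μ }

def etaSup (Φ : ℝ → ℝ) (K : X → Y → ℝ) : ℝ :=
  sSup { r | ∃ μ : X → ℝ, IsPosDist μ ∧ r = eta Φ μ K }

def maxCorr (μ : X → ℝ) (K : X → Y → ℝ) : ℝ :=
  sSup { r | ∃ (f : X → ℝ) (g : Y → ℝ),
    (∑ x, μ x * f x) = 0 ∧ (∑ y, push μ K y * g y) = 0 ∧
    (∑ x, μ x * (f x) ^ 2) = 1 ∧ (∑ y, push μ K y * (g y) ^ 2) = 1 ∧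
    r = ∑ x, ∑ y, μ x * K x y * (f x * g y) }

def adjoint (μ : X → ℝ) (K : X → Y → ℝ) : Y → X → ℝ :=
  fun y x => K x y * μ x / push μ K y

def Ent (Φ : ℝ → ℝ) (μ : X → ℝ) (f : X → ℝ) : ℝ :=
  (∑ x, μ x * Φ (f x)) - Φ (∑ x, μ x * f x)

def Var (μ : X → ℝ) (f : X → ℝ) : ℝ :=
  ∑ x, μ x * (f x - ∑ x', μ x' * f x') ^ 2

def condExp (μ : X → ℝ) (K : X → Y → ℝ) (f : X → ℝ) : Y → ℝ :=
  fun y => (∑ x, μ x * K x y * f x) / push μ K y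

def calE (μ : X → ℝ) (K : X → Y → ℝ) (f g : X → ℝ) : ℝ :=
  ∑ x, ∑ y, μ x * K x y *
    ((f x - condExp μ K f y) * (g x - condExp μ K g y))

def dirichlet (μ : X → ℝ) (M : X → X → ℝ) (f g : X → ℝ) : ℝ :=
  (1 / 2) * ∑ x, ∑ x', μ x * M x x' * ((f x - f x') * (g x - g x'))

def Homogeneous (Φ : ℝ → ℝ) : Prop :=
  ∃ κ : ℝ → ℝ, (∀ c : ℝ, 0 < c → 0 < κ c) ∧
    ∀ (c : ℝ), 0 < c → ∀ (Z : Type) [Fintype Z], ∀ (μ : Z → ℝ),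
      IsDist μ → ∀ f : Z → ℝ, (∀ z, 0 ≤ f z) →
        Ent Φ μ (fun z => c * f z) = κ c * Ent Φ μ f

def Subadditive (Φ : ℝ → ℝ) : Prop :=
  ∀ (n : ℕ) (Z : Fin n → Type) [∀ i, Fintype (Z i)],
    ∀ (μ : ∀ i, Z i → ℝ), (∀ i, IsDist (μ i)) →
    ∀ f : (∀ i, Z i) → ℝ, (∀ z, 0 ≤ f z) →
      Ent Φ (fun z : ∀ i, Z i => ∏ i, μ i (z i)) f ≤
        ∑ i : Fin n,
          ((∑ z : ∀ j, Z j, (∏ j, μ j (z j)) * Φ (f z)) -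
            ∑ z : ∀ j, Z j, (∏ j, μ j (z j)) *
              Φ (∑ w : Z i, μ i w * f (Function.update z i w)))


lemma isPosDist_push {μ : X → ℝ} {K : X → Y → ℝ} (hμ : IsPosDist μ) (hK : IsChannel K)
    (hadm : ∀ y, 0 < push μ K y) : IsPosDist (push μ K) := by
  refine ⟨hadm, ?_⟩
  unfold push
  rw [Finset.sum_comm]
  simp_rw [← Finset.mul_sum, hK.2, mul_one]
  exact hμ.2

lemma IsPosDist.isDist {μ : X → ℝ} (hμ : IsPosDist μ) : IsDist μ :=
  ⟨fun x => (hμ.1 x).le, hμ.2⟩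

set_option linter.unusedSectionVars false in
lemma condExp_eq_sum (μ : X → ℝ) (K : X → Y → ℝ) (f : X → ℝ) (y : Y) :
    condExp μ K f y = ∑ x, (μ x * K x y / push μ K y) • f x := by
  unfold condExp
  rw [Finset.sum_div]
  refine Finset.sum_congr rfl fun x _ => ?_
  rw [smul_eq_mul]
  ring

/-- The backward channel of an admissible pair has nonnegative weights. -/
lemma backward_nonneg {μ : X → ℝ} {K : X → Y → ℝ} (hμ : IsPosDist μ) (hK : IsChannel K)
    (hadm : ∀ y, 0 < push μ K y) (y : Y) (x : X) : 0 ≤ μ x * K x y / push μ K y :=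
  div_nonneg (mul_nonneg (hμ.1 x).le (hK.1 x y)) (hadm y).le

set_option linter.unusedSectionVars false in
/-- The backward channel of an admissible pair has total mass one. -/
lemma sum_backward {μ : X → ℝ} {K : X → Y → ℝ}
    (hadm : ∀ y, 0 < push μ K y) (y : Y) : ∑ x, μ x * K x y / push μ K y = 1 := by
  rw [← Finset.sum_div]
  exact div_self (hadm y).ne'

lemma condExp_mem {μ : X → ℝ} {K : X → Y → ℝ} (hμ : IsPosDist μ) (hK : IsChannel K)
    (hadm : ∀ y, 0 < push μ K y) {s : Set ℝ} (hs : Convex ℝ s) {f : X → ℝ}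
    (hf : ∀ x, f x ∈ s) (y : Y) : condExp μ K f y ∈ s := by
  rw [condExp_eq_sum]
  exact hs.sum_mem (fun x _ => backward_nonneg hμ hK hadm y x) (sum_backward hadm y)
    (fun x _ => hf x)

/-- Conditional Jensen inequality for convex functions. -/
lemma map_condExp_le {μ : X → ℝ} {K : X → Y → ℝ} (hμ : IsPosDist μ) (hK : IsChannel K)
    (hadm : ∀ y, 0 < push μ K y) {s : Set ℝ} {Φ : ℝ → ℝ} (hΦ : ConvexOn ℝ s Φ) {f : X → ℝ}
    (hf : ∀ x, f x ∈ s) (y : Y) :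
    Φ (condExp μ K f y) ≤ condExp μ K (fun x => Φ (f x)) y := by
  rw [condExp_eq_sum, condExp_eq_sum]
  exact hΦ.map_sum_le (fun x _ => backward_nonneg hμ hK hadm y x) (sum_backward hadm y)
    (fun x _ => hf x)

/-- Conditional Jensen inequality for concave functions. -/
lemma condExp_le_map {μ : X → ℝ} {K : X → Y → ℝ} (hμ : IsPosDist μ) (hK : IsChannel K)
    (hadm : ∀ y, 0 < push μ K y) {s : Set ℝ} {Ψ : ℝ → ℝ} (hΨ : ConcaveOn ℝ s Ψ) {f : X → ℝ}
    (hf : ∀ x, f x ∈ s) (y : Y) :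
    condExp μ K (fun x => Ψ (f x)) y ≤ Ψ (condExp μ K f y) := by
  rw [condExp_eq_sum, condExp_eq_sum]
  exact hΨ.le_map_sum (fun x _ => backward_nonneg hμ hK hadm y x) (sum_backward hadm y)
    (fun x _ => hf x)

set_option linter.unusedSectionVars false in
lemma push_mul_condExp {μ : X → ℝ} {K : X → Y → ℝ} (hadm : ∀ y, 0 < push μ K y)
    (f : X → ℝ) (y : Y) : push μ K y * condExp μ K f y = ∑ x, μ x * K x y * f x :=
  mul_div_cancel₀ _ (hadm y).ne'

/-- The tower property. -/
lemma sum_push_mul_condExp {μ : X → ℝ} {K : X → Y → ℝ} (hK : IsChannel K)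
    (hadm : ∀ y, 0 < push μ K y) (f : X → ℝ) :
    ∑ y, push μ K y * condExp μ K f y = ∑ x, μ x * f x := by
  simp_rw [push_mul_condExp hadm]
  rw [Finset.sum_comm]
  refine Finset.sum_congr rfl fun x _ => ?_
  rw [← Finset.sum_mul, ← Finset.mul_sum, hK.2, mul_one]

set_option linter.unusedSectionVars false in
lemma condExp_const_mul (μ : X → ℝ) (K : X → Y → ℝ) (a : ℝ) (f : X → ℝ) (y : Y) :
    condExp μ K (fun x => a * f x) y = a * condExp μ K f y := by
  unfold condExp
  rw [← mul_div_assoc, Finset.mul_sum]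
  congr 1
  exact Finset.sum_congr rfl fun x _ => by ring

lemma Ent_nonneg {Φ : ℝ → ℝ} (hΦ : ConvexOn ℝ (Set.Ici 0) Φ) {μ : X → ℝ} (hμ : IsDist μ)
    {f : X → ℝ} (hf : ∀ x, 0 ≤ f x) : 0 ≤ Ent Φ μ f :=
  sub_nonneg.mpr (hΦ.map_sum_le (fun x _ => hμ.1 x) hμ.2 (fun x _ => hf x))

/-- The data processing inequality for `Φ`-entropies. -/
lemma Ent_condExp_le {Φ : ℝ → ℝ} (hΦ : ConvexOn ℝ (Set.Ici 0) Φ) {μ : X → ℝ} {K : X → Y → ℝ}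
    (hμ : IsPosDist μ) (hK : IsChannel K) (hadm : ∀ y, 0 < push μ K y)
    {f : X → ℝ} (hf : ∀ x, 0 ≤ f x) : Ent Φ (push μ K) (condExp μ K f) ≤ Ent Φ μ f := by
  unfold Ent
  rw [sum_push_mul_condExp hK hadm, ← sum_push_mul_condExp hK hadm (fun x => Φ (f x))]
  gcongr with y _
  · exact (hadm y).le
  · exact map_condExp_le hμ hK hadm hΦ hf y

lemma sum_mul_div_cancel {μ : X → ℝ} (hμ : ∀ x, 0 < μ x) (ν : X → ℝ) :
    ∑ x, μ x * (ν x / μ x) = ∑ x, ν x :=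
  Finset.sum_congr rfl fun x _ => mul_div_cancel₀ _ (hμ x).ne'

lemma fDiv_eq_Ent (Φ : ℝ → ℝ) {μ ν : X → ℝ} (hμ : ∀ x, 0 < μ x) (hν : IsDist ν) :
    fDiv Φ ν μ = Ent Φ μ (fun x => ν x / μ x) := by
  unfold fDiv Ent
  rw [sum_mul_div_cancel hμ, hν.2]

lemma fDiv_push_eq_Ent (Φ : ℝ → ℝ) {μ ν : X → ℝ} {K : X → Y → ℝ} (hμ : ∀ x, 0 < μ x)
    (hν : IsDist ν) (hK : IsChannel K) (hadm : ∀ y, 0 < push μ K y) :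
    fDiv Φ (push ν K) (push μ K) =
      Ent Φ (push μ K) (condExp μ K (fun x => ν x / μ x)) := by
  have h : ∀ y, condExp μ K (fun x => ν x / μ x) y = push ν K y / push μ K y := by
    intro y
    unfold condExp
    congr 1
    refine Finset.sum_congr rfl fun x _ => ?_
    have := (hμ x).ne'
    field_simp
  unfold Ent
  rw [sum_push_mul_condExp hK hadm, sum_mul_div_cancel hμ, hν.2]
  simp_rw [h]
  rfl

/-- The strong data processing inequality, in terms of densities of mean one. -/
lemma Ent_condExp_le_of_eta_le {Φ : ℝ → ℝ} (hΦ : ConvexOn ℝ (Set.Ici 0) Φ) {μ : X → ℝ}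
    {K : X → Y → ℝ} (hμ : IsPosDist μ) (hK : IsChannel K) (hadm : ∀ y, 0 < push μ K y)
    {c : ℝ} (hη : eta Φ μ K ≤ c) {f : X → ℝ} (hf : ∀ x, 0 ≤ f x) (hf1 : ∑ x, μ x * f x = 1) :
    Ent Φ (push μ K) (condExp μ K f) ≤ c * Ent Φ μ f := by
  have hle := Ent_condExp_le hΦ hμ hK hadm hf
  have hnum : 0 ≤ Ent Φ (push μ K) (condExp μ K f) :=
    Ent_nonneg hΦ (isPosDist_push hμ hK hadm).isDist
      (condExp_mem hμ hK hadm (convex_Ici 0) hf)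
  rcases (Ent_nonneg hΦ hμ.isDist hf).eq_or_lt with h0 | hpos
  · rw [← h0] at hle ⊢
    simpa using hle
  have hbdd : BddAbove { r | ∃ ν : X → ℝ, IsDist ν ∧ ν ≠ μ ∧
      r = fDiv Φ (push ν K) (push μ K) / fDiv Φ ν μ } := by
    refine ⟨1, ?_⟩
    rintro r ⟨ν, hν, -, rfl⟩
    have hnn : ∀ x, 0 ≤ ν x / μ x := fun x => div_nonneg (hν.1 x) (hμ.1 x).le
    rw [fDiv_eq_Ent Φ hμ.1 hν, fDiv_push_eq_Ent Φ hμ.1 hν hK hadm]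
    exact div_le_one_of_le₀ (Ent_condExp_le hΦ hμ hK hadm hnn) (Ent_nonneg hΦ hμ.isDist hnn)
  have hν : IsDist (fun x => μ x * f x) := ⟨fun x => mul_nonneg (hμ.1 x).le (hf x), hf1⟩
  have hdens : (fun x => μ x * f x / μ x) = f :=
    funext fun x => mul_div_cancel_left₀ _ (hμ.1 x).ne'
  have hne : (fun x => μ x * f x) ≠ μ := by
    intro h
    have hone : f = fun _ => 1 := by
      rw [← hdens]
      funext x
      have hx : μ x * f x = μ x := congrFun h x
      rw [hx]
      exact div_self (hμ.1 x).ne'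
    refine hpos.ne' ?_
    rw [hone]
    simp [Ent, ← Finset.sum_mul, hμ.2]
  have hr := (le_csSup hbdd ⟨_, hν, hne, rfl⟩).trans hη
  rw [fDiv_eq_Ent Φ hμ.1 hν, fDiv_push_eq_Ent Φ hμ.1 hν hK hadm, hdens] at hr
  exact (div_le_iff₀ hpos).mp hr

lemma calE_eq {μ : X → ℝ} {K : X → Y → ℝ} (hK : IsChannel K) (hadm : ∀ y, 0 < push μ K y)
    (f g : X → ℝ) :
    calE μ K f g = (∑ x, μ x * (f x * g x)) -
      ∑ y, push μ K y * (condExp μ K f y * condExp μ K g y) := by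
  rw [← sum_push_mul_condExp hK hadm, ← Finset.sum_sub_distrib]
  unfold calE
  rw [Finset.sum_comm]
  refine Finset.sum_congr rfl fun y _ => ?_
  have hp : ∑ x, μ x * K x y = push μ K y := rfl
  have hF := push_mul_condExp hadm f y
  have hG := push_mul_condExp hadm g y
  have key : ∑ x, μ x * K x y * ((f x - condExp μ K f y) * (g x - condExp μ K g y)) =
      (∑ x, μ x * K x y * (f x * g x)) - (∑ x, μ x * K x y * f x) * condExp μ K g y
        - (∑ x, μ x * K x y * g x) * condExp μ K f y
        + (∑ x, μ x * K x y) * (condExp μ K f y * condExp μ K g y) := by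
    simp only [Finset.sum_mul, ← Finset.sum_sub_distrib, ← Finset.sum_add_distrib]
    exact Finset.sum_congr rfl fun x _ => by ring
  rw [key, hp, ← hF, ← hG, push_mul_condExp hadm (fun x => f x * g x) y]
  ring

/-- The entropy lost under conditioning is bounded by the conditional covariance with `Ψ ∘ f`. -/
lemma Ent_sub_Ent_condExp_le_calE {Φ : ℝ → ℝ}
    (hΨ : ConcaveOn ℝ (Set.Ioi 0) (fun u => (Φ u - Φ 0) / u)) {μ : X → ℝ} {K : X → Y → ℝ}
    (hμ : IsPosDist μ) (hK : IsChannel K) (hadm : ∀ y, 0 < push μ K y)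
    {f : X → ℝ} (hf : ∀ x, 0 < f x) :
    Ent Φ μ f - Ent Φ (push μ K) (condExp μ K f) ≤
      calE μ K f (fun x => (Φ (f x) - Φ 0) / f x) := by
  have hF : ∀ y, 0 < condExp μ K f y := condExp_mem hμ hK hadm (convex_Ioi 0) hf
  have hcond : ∀ y, condExp μ K f y * condExp μ K (fun x => (Φ (f x) - Φ 0) / f x) y ≤
      Φ (condExp μ K f y) - Φ 0 := by
    intro y
    have h := mul_le_mul_of_nonneg_left (condExp_le_map hμ hK hadm hΨ hf y) (hF y).le
    rwa [mul_div_cancel₀ _ (hF y).ne'] at h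
  have hsum : ∑ y, push μ K y *
      (condExp μ K f y * condExp μ K (fun x => (Φ (f x) - Φ 0) / f x) y) ≤
      (∑ y, push μ K y * Φ (condExp μ K f y)) - Φ 0 := by
    calc _ ≤ ∑ y, push μ K y * (Φ (condExp μ K f y) - Φ 0) :=
          Finset.sum_le_sum fun y _ => mul_le_mul_of_nonneg_left (hcond y) (hadm y).le
      _ = _ := by
          simp_rw [mul_sub]
          rw [Finset.sum_sub_distrib, ← Finset.sum_mul, (isPosDist_push hμ hK hadm).2,
            one_mul]
  have hprod : ∑ x, μ x * (f x * ((Φ (f x) - Φ 0) / f x)) = (∑ x, μ x * Φ (f x)) - Φ 0 := by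
    simp_rw [fun x => mul_div_cancel₀ (Φ (f x) - Φ 0) (hf x).ne', mul_sub]
    rw [Finset.sum_sub_distrib, ← Finset.sum_mul, hμ.2, one_mul]
  rw [calE_eq hK hadm, hprod]
  unfold Ent
  rw [sum_push_mul_condExp hK hadm]
  linarith

/-- Theorem (SDPI implies Φ-Sobolev inequality): if `Φ` is convex with `Φ(0)` finite,
`Ψ(u) = (Φ(u) − Φ(0))/u` is concave on `(0,∞)`, the `Φ`-entropy is homogeneous, and
`η_Φ(μ,K) ≤ c < 1`, then for every strictly positive `f : X → (0,∞)`,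
`Ent_Φ[f(X)] ≤ (1/(1−c))·ℰ(f(X), Ψ∘f(X) | Y)`, where `(X,Y) ~ μ⊗K`. -/
theorem statement12 {X Y : Type} [Fintype X] [Fintype Y] [Nonempty X] [Nonempty Y]
    (Φ : ℝ → ℝ) (hconv : ConvexOn ℝ (Set.Ici 0) Φ)
    (hΨconc : ConcaveOn ℝ (Set.Ioi 0) (fun u => (Φ u - Φ 0) / u))
    (hhom : Homogeneous Φ)
    (μ : X → ℝ) (K : X → Y → ℝ) (hμ : IsPosDist μ) (hK : IsChannel K)
    (hadm : ∀ y, 0 < push μ K y)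
    (c : ℝ) (hc : c < 1) (hη : eta Φ μ K ≤ c)
    (f : X → ℝ) (hf : ∀ x, 0 < f x) :
    Ent Φ μ f ≤ (1 / (1 - c)) * calE μ K f (fun x => (Φ (f x) - Φ 0) / f x) := by
  set m : ℝ := ∑ x, μ x * f x with hm
  have hmpos : 0 < m :=
    Finset.sum_pos (fun x _ => mul_pos (hμ.1 x) (hf x)) Finset.univ_nonempty
  set g : X → ℝ := fun x => m⁻¹ * f x with hg
  have hg0 : ∀ x, 0 ≤ g x := fun x => (mul_pos (inv_pos.mpr hmpos) (hf x)).le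
  have hg1 : ∑ x, μ x * g x = 1 := by
    simp_rw [hg, mul_left_comm (μ _)]
    rw [← Finset.mul_sum, ← hm, inv_mul_cancel₀ hmpos.ne']
  have hfg : f = fun x => m * g x := funext fun x => (mul_inv_cancel_left₀ hmpos.ne' _).symm
  have hsdpi := Ent_condExp_le_of_eta_le hconv hμ hK hadm hη hg0 hg1
  obtain ⟨κ, hκ, hscale⟩ := hhom
  have hX : Ent Φ μ f = κ m * Ent Φ μ g := by
    rw [hfg]
    exact hscale m hmpos X μ hμ.isDist g hg0
  have hY : Ent Φ (push μ K) (condExp μ K f) =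
      κ m * Ent Φ (push μ K) (condExp μ K g) := by
    have h : condExp μ K f = fun y => m * condExp μ K g y := by
      rw [hfg]
      exact funext (condExp_const_mul μ K m g)
    rw [h]
    exact hscale m hmpos Y _ (isPosDist_push hμ hK hadm).isDist _
      (condExp_mem hμ hK hadm (convex_Ici 0) hg0)
  have hcontr := mul_le_mul_of_nonneg_left hsdpi (hκ m hmpos).le
  rw [← hY, mul_left_comm, ← hX] at hcontr
  have hloss := Ent_sub_Ent_condExp_le_calE hΨconc hμ hK hadm hf
  rw [one_div_mul_eq_div, le_div_iff₀ (sub_pos.mpr hc)]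
  linarith

end SDPI
end
end

section
/- Let Φ : [0,∞) → ℝ be convex with Φ(0) finite, such that Ψ(u) = (Φ(u) − Φ(0))/u is concave and differentiable on (0,∞) and the Φ-entropy is homogeneous. Let (μ,K) be admissible with η_Φ(μ,K) ≤ c for some c < 1. Let F : ℝ → (0,∞) be convex, differentiable, and nondecreasing, with Ψ∘F convex. Then for every f : X → ℝ: Ent_Φ[F(f(X))] ≤ (1/(1−c))·E[ F'(f(X))²·Ψ'(F(f(X)))·((f(X) − f(X'))₊)² ], where (u)₊ = max(u,0), X ~ μ, and (X,X') is the exchangeable pair with joint law P(X=x, X'=x') = μ(x)·Σ_y K*(x'|y)K(y|x). -/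
open Finset

noncomputable section

namespace SDPI

variable {X Y : Type} [Fintype X] [Fintype Y]

lemma adjoint_isDist {μ : X → ℝ} {K : X → Y → ℝ} (hμ : IsPosDist μ) (hK : IsChannel K)
    (hadm : ∀ y, 0 < push μ K y) (y : Y) : IsDist (adjoint μ K y) := by
  refine ⟨fun x => div_nonneg (mul_nonneg (hK.1 x y) (hμ.1 x).le) (hadm y).le, ?_⟩
  simp only [adjoint]
  rw [← Finset.sum_div, div_eq_one_iff_eq (hadm y).ne']
  exact Finset.sum_congr rfl fun x _ => mul_comm _ _

lemma push_mul_adjoint {X Y : Type} [Fintype X] {μ : X → ℝ} {K : X → Y → ℝ}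
    (hadm : ∀ y, 0 < push μ K y) (x : X) (y : Y) :
    push μ K y * adjoint μ K y x = μ x * K x y := by
  simp only [adjoint]
  rw [mul_div_cancel₀ _ (hadm y).ne', mul_comm]

lemma push_isDist {μ : X → ℝ} {K : X → Y → ℝ} (hμ : IsPosDist μ) (hK : IsChannel K) :
    IsDist (push μ K) := by
  refine ⟨fun y => Finset.sum_nonneg fun x _ => mul_nonneg (hμ.1 x).le (hK.1 x y), ?_⟩
  simp only [push]
  rw [Finset.sum_comm]
  simp only [← Finset.mul_sum, hK.2, mul_one, hμ.2]

lemma condExp_eq_sum_adjoint {X Y : Type} [Fintype X] (μ : X → ℝ) (K : X → Y → ℝ) (g : X → ℝ)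
    (y : Y) :
    condExp μ K g y = ∑ x, adjoint μ K y x * g x := by
  simp only [condExp, adjoint, Finset.sum_div]
  exact Finset.sum_congr rfl fun x _ => by ring

lemma sum_push_mul_sum_adjoint {μ : X → ℝ} {K : X → Y → ℝ} (hK : IsChannel K)
    (hadm : ∀ y, 0 < push μ K y) (h : X → ℝ) :
    ∑ y, push μ K y * ∑ x, adjoint μ K y x * h x = ∑ x, μ x * h x := by
  simp only [Finset.mul_sum, ← mul_assoc, push_mul_adjoint hadm]
  rw [Finset.sum_comm]
  refine Finset.sum_congr rfl fun x _ => ?_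
  rw [← Finset.sum_mul, ← Finset.mul_sum, hK.2, mul_one]

lemma ent_nonneg {Φ : ℝ → ℝ} (hconv : ConvexOn ℝ (Set.Ici 0) Φ) {ν : X → ℝ} (hν : IsDist ν)
    {g : X → ℝ} (hg : ∀ x, 0 ≤ g x) : 0 ≤ Ent Φ ν g := by
  have := hconv.map_sum_le (t := Finset.univ) (w := ν) (p := g) (fun x _ => hν.1 x) hν.2
    (fun x _ => hg x)
  simp only [smul_eq_mul] at this
  exact sub_nonneg.2 this

/-- The chain rule for `Φ`-entropy along a channel. -/
lemma ent_eq_ent_condExp_add {μ : X → ℝ} {K : X → Y → ℝ} (hK : IsChannel K)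
    (hadm : ∀ y, 0 < push μ K y) (Φ : ℝ → ℝ) (g : X → ℝ) :
    Ent Φ μ g = Ent Φ (push μ K) (condExp μ K g) +
      ∑ y, push μ K y * Ent Φ (adjoint μ K y) g := by
  simp only [Ent, condExp_eq_sum_adjoint, mul_sub, Finset.sum_sub_distrib,
    sum_push_mul_sum_adjoint hK hadm]
  ring

lemma ent_condExp_le {Φ : ℝ → ℝ} (hconv : ConvexOn ℝ (Set.Ici 0) Φ) {μ : X → ℝ} {K : X → Y → ℝ}
    (hμ : IsPosDist μ) (hK : IsChannel K) (hadm : ∀ y, 0 < push μ K y) {g : X → ℝ}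
    (hg : ∀ x, 0 ≤ g x) : Ent Φ (push μ K) (condExp μ K g) ≤ Ent Φ μ g := by
  rw [ent_eq_ent_condExp_add hK hadm]
  exact le_add_of_nonneg_right <| Finset.sum_nonneg fun y _ =>
    mul_nonneg (hadm y).le (ent_nonneg hconv (adjoint_isDist hμ hK hadm y) hg)

lemma condExp_nonneg {μ : X → ℝ} {K : X → Y → ℝ} (hμ : IsPosDist μ) (hK : IsChannel K)
    (hadm : ∀ y, 0 < push μ K y) {g : X → ℝ} (hg : ∀ x, 0 ≤ g x) (y : Y) :
    0 ≤ condExp μ K g y := by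
  rw [condExp_eq_sum_adjoint]
  exact Finset.sum_nonneg fun x _ => mul_nonneg ((adjoint_isDist hμ hK hadm y).1 x) (hg x)

lemma fDiv_eq_ent (Φ : ℝ → ℝ) {ν μ : X → ℝ} (hμ : IsPosDist μ) (hν : IsDist ν) :
    fDiv Φ ν μ = Ent Φ μ (fun x => ν x / μ x) := by
  simp only [fDiv, Ent, mul_div_cancel₀ _ (hμ.1 _).ne', hν.2]

lemma fDiv_push_eq_ent (Φ : ℝ → ℝ) {ν μ : X → ℝ} {K : X → Y → ℝ} (hμ : IsPosDist μ)
    (hK : IsChannel K) (hadm : ∀ y, 0 < push μ K y) (hν : IsDist ν) :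
    fDiv Φ (push ν K) (push μ K) =
      Ent Φ (push μ K) (condExp μ K (fun x => ν x / μ x)) := by
  have hc : ∀ y, condExp μ K (fun x => ν x / μ x) y = push ν K y / push μ K y := fun y => by
    simp only [condExp, push]
    congr 1
    refine Finset.sum_congr rfl fun x _ => ?_
    have := (hμ.1 x).ne'
    field_simp
  have hs : ∑ y, push ν K y = 1 := by
    simp only [push]
    rw [Finset.sum_comm]
    simp only [← Finset.mul_sum, hK.2, mul_one, hν.2]
  simp only [fDiv, Ent, hc, mul_div_cancel₀ _ (hadm _).ne', hs]

/-- The strong data processing inequality for densities with mean one. -/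
lemma ent_condExp_le_of_eta_le {Φ : ℝ → ℝ} (hconv : ConvexOn ℝ (Set.Ici 0) Φ) {μ : X → ℝ}
    {K : X → Y → ℝ} (hμ : IsPosDist μ) (hK : IsChannel K) (hadm : ∀ y, 0 < push μ K y) {c : ℝ}
    (hη : eta Φ μ K ≤ c) {g : X → ℝ} (hg : ∀ x, 0 ≤ g x) (hg1 : ∑ x, μ x * g x = 1) :
    Ent Φ (push μ K) (condExp μ K g) ≤ c * Ent Φ μ g := by
  have hnum := ent_nonneg hconv (push_isDist hμ hK) (condExp_nonneg hμ hK hadm hg)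
  have hle := ent_condExp_le hconv hμ hK hadm hg
  rcases (ent_nonneg hconv ⟨fun x => (hμ.1 x).le, hμ.2⟩ hg).eq_or_lt with h0 | hpos
  · rw [← h0] at hle ⊢
    simpa using hle
  have hdist : IsDist fun x => μ x * g x := ⟨fun x => mul_nonneg (hμ.1 x).le (hg x), hg1⟩
  have hquot : (fun x => μ x * g x / μ x) = g :=
    funext fun x => mul_div_cancel_left₀ _ (hμ.1 x).ne'
  have hne : (fun x => μ x * g x) ≠ μ := by
    intro h
    have hone : g = fun _ => 1 := by
      rw [← hquot]
      funext x
      rw [congrFun h x, div_self (hμ.1 x).ne']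
    simp [Ent, hone, hμ.2, ← Finset.sum_mul] at hpos
  have hbdd : BddAbove {r | ∃ ν : X → ℝ, IsDist ν ∧ ν ≠ μ ∧
      r = fDiv Φ (push ν K) (push μ K) / fDiv Φ ν μ} := by
    refine ⟨1, ?_⟩
    rintro _ ⟨ν, hν, -, rfl⟩
    have hd : ∀ x, 0 ≤ ν x / μ x := fun x => div_nonneg (hν.1 x) (hμ.1 x).le
    rw [fDiv_push_eq_ent Φ hμ hK hadm hν, fDiv_eq_ent Φ hμ hν]
    exact div_le_one_of_le₀ (ent_condExp_le hconv hμ hK hadm hd)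
      (ent_nonneg hconv ⟨fun x => (hμ.1 x).le, hμ.2⟩ hd)
  have hr := (le_csSup hbdd ⟨_, hdist, hne, rfl⟩).trans hη
  rw [fDiv_push_eq_ent Φ hμ hK hadm hdist, fDiv_eq_ent Φ hμ hdist, hquot] at hr
  exact (div_le_iff₀ hpos).1 hr

lemma ent_condExp_le_of_homogeneous {Φ : ℝ → ℝ} (hconv : ConvexOn ℝ (Set.Ici 0) Φ)
    (hhom : Homogeneous Φ) {μ : X → ℝ} {K : X → Y → ℝ} (hμ : IsPosDist μ) (hK : IsChannel K)
    (hadm : ∀ y, 0 < push μ K y) {c : ℝ} (hη : eta Φ μ K ≤ c) {g : X → ℝ}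
    (hg : ∀ x, 0 ≤ g x) (hmean : 0 < ∑ x, μ x * g x) :
    Ent Φ (push μ K) (condExp μ K g) ≤ c * Ent Φ μ g := by
  obtain ⟨κ, hκ, hent⟩ := hhom
  set m := ∑ x, μ x * g x with hm
  have hgm : ∀ x, 0 ≤ g x / m := fun x => div_nonneg (hg x) hmean.le
  have h1 : ∑ x, μ x * (g x / m) = 1 := by
    simp only [← mul_div_assoc]
    rw [← Finset.sum_div, ← hm, div_self hmean.ne']
  have hscale : g = fun x => m * (g x / m) := funext fun x => (mul_div_cancel₀ _ hmean.ne').symm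
  have hcscale : condExp μ K g = fun y => m * condExp μ K (fun x => g x / m) y := by
    funext y
    simp only [condExp_eq_sum_adjoint, Finset.mul_sum]
    refine Finset.sum_congr rfl fun x _ => ?_
    field_simp
  have hX : Ent Φ μ g = κ m * Ent Φ μ (fun x => g x / m) := by
    conv_lhs => rw [hscale]
    exact hent m hmean X μ ⟨fun x => (hμ.1 x).le, hμ.2⟩ _ hgm
  rw [hX, hcscale, hent m hmean Y _ (push_isDist hμ hK) _ (condExp_nonneg hμ hK hadm hgm)]
  calc _ ≤ κ m * (c * Ent Φ μ fun x => g x / m) :=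
        mul_le_mul_of_nonneg_left (ent_condExp_le_of_eta_le hconv hμ hK hadm hη hgm h1)
          (hκ m hmean).le
    _ = _ := by ring

/-- If `Φ(u) = Φ(0) + u Ψ(u)` with `Ψ` concave, the `Φ`-entropy of a positive function is at most
the covariance of that function with its image under `Ψ`. -/
lemma two_mul_ent_le {Φ : ℝ → ℝ}
    (hΨconc : ConcaveOn ℝ (Set.Ioi 0) (fun u => (Φ u - Φ 0) / u)) {w : X → ℝ} (hw : IsDist w)
    {g : X → ℝ} (hg : ∀ x, 0 < g x) :
    2 * Ent Φ w g ≤ ∑ x, ∑ x', w x * w x' *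
      ((g x - g x') * ((Φ (g x) - Φ 0) / g x - (Φ (g x') - Φ 0) / g x')) := by
  set Ψ : ℝ → ℝ := fun u => (Φ u - Φ 0) / u with hΨ
  have hΦ : ∀ u, 0 < u → Φ u = Φ 0 + u * Ψ u := fun u hu => by
    simp only [hΨ]
    rw [mul_div_cancel₀ _ hu.ne']
    ring
  have hjensen : ∑ x, w x * Ψ (g x) ≤ Ψ (∑ x, w x * g x) := by
    simpa only [smul_eq_mul] using hΨconc.le_map_sum (t := Finset.univ) (w := w) (p := g)
      (fun x _ => hw.1 x) hw.2 (fun x _ => hg x)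
  have hmean : 0 < ∑ x, w x * g x := by
    obtain ⟨x, -, hx⟩ : ∃ x ∈ Finset.univ, 0 < w x :=
      Finset.exists_lt_of_sum_lt (f := fun _ => (0 : ℝ)) (by simp [hw.2])
    exact Finset.sum_pos' (fun x _ => mul_nonneg (hw.1 x) (hg x).le)
      ⟨x, Finset.mem_univ x, mul_pos hx (hg x)⟩
  have hent : Ent Φ w g =
      ∑ x, w x * (g x * Ψ (g x)) - (∑ x, w x * g x) * Ψ (∑ x, w x * g x) := by
    simp only [Ent, hΦ _ (hg _), hΦ _ hmean, mul_add, Finset.sum_add_distrib]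
    rw [← Finset.sum_mul, hw.2]
    ring
  have hcov : ∑ x, ∑ x', w x * w x' * ((g x - g x') * (Ψ (g x) - Ψ (g x'))) =
      2 * (∑ x, w x * (g x * Ψ (g x)) - (∑ x, w x * g x) * ∑ x, w x * Ψ (g x)) := by
    have : ∀ x x', w x * w x' * ((g x - g x') * (Ψ (g x) - Ψ (g x'))) =
        w x * (g x * Ψ (g x)) * w x' - w x * g x * (w x' * Ψ (g x')) -
          w x * Ψ (g x) * (w x' * g x') + w x * (w x' * (g x' * Ψ (g x'))) := fun x x' => by ring
    simp only [this, Finset.sum_add_distrib, Finset.sum_sub_distrib, ← Finset.mul_sum,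
      ← Finset.sum_mul, hw.2]
    ring
  change _ ≤ ∑ x, ∑ x', w x * w x' * ((g x - g x') * (Ψ (g x) - Ψ (g x')))
  rw [hcov, hent]
  have := mul_le_mul_of_nonneg_left hjensen hmean.le
  linarith

lemma sub_le_mul_of_convexOn_of_hasDerivAt {G : ℝ → ℝ} {G' a b : ℝ}
    (hG : ConvexOn ℝ Set.univ G) (hd : HasDerivAt G G' a) (hab : b < a) :
    G a - G b ≤ G' * (a - b) := by
  have := hG.slope_le_of_hasDerivAt (Set.mem_univ b) (Set.mem_univ a) hab hd
  rwa [slope_def_field, div_le_iff₀ (sub_pos.2 hab)] at this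

lemma hasDerivAt_nonneg_of_convexOn {Φ : ℝ → ℝ} (hconv : ConvexOn ℝ (Set.Ici 0) Φ)
    (hΨconc : ConcaveOn ℝ (Set.Ioi 0) (fun u => (Φ u - Φ 0) / u)) {u p : ℝ} (hu : 0 < u)
    (hd : HasDerivAt (fun v => (Φ v - Φ 0) / v) p u) : 0 ≤ p := by
  have hu1 : 0 < u + 1 := by linarith
  have hs := hΨconc.slope_le_of_hasDerivAt (Set.mem_Ioi.2 hu) (Set.mem_Ioi.2 hu1)
    (lt_add_one u) hd
  refine le_trans ?_ hs
  have := hconv.secant_mono (Set.mem_Ici.2 le_rfl) (Set.mem_Ici.2 hu.le) (Set.mem_Ici.2 hu1.le)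
    hu.ne' hu1.ne' (lt_add_one u).le
  simp only [sub_zero] at this
  rw [slope_def_field]
  exact div_nonneg (sub_nonneg.2 this) (by linarith)

/-- The two-point bound: the symmetrised increment is controlled by the one-sided gradient. -/
lemma mul_increment_le {Φ Ψ' : ℝ → ℝ} (hconv : ConvexOn ℝ (Set.Ici 0) Φ)
    (hΨconc : ConcaveOn ℝ (Set.Ioi 0) (fun u => (Φ u - Φ 0) / u))
    (hΨdiff : ∀ u ∈ Set.Ioi (0 : ℝ), HasDerivAt (fun v => (Φ v - Φ 0) / v) (Ψ' u) u)
    {F F' : ℝ → ℝ} (hFpos : ∀ t, 0 < F t) (hFconv : ConvexOn ℝ Set.univ F)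
    (hFdiff : ∀ t, HasDerivAt F (F' t) t) (hFmono : Monotone F)
    (hΨF : ConvexOn ℝ Set.univ (fun t => (Φ (F t) - Φ 0) / F t)) (a b : ℝ) :
    (F a - F b) * ((Φ (F a) - Φ 0) / F a - (Φ (F b) - Φ 0) / F b) ≤
      (F' a) ^ 2 * Ψ' (F a) * (max (a - b) 0) ^ 2 +
        (F' b) ^ 2 * Ψ' (F b) * (max (b - a) 0) ^ 2 := by
  have key : ∀ a b : ℝ, b < a →
      (F a - F b) * ((Φ (F a) - Φ 0) / F a - (Φ (F b) - Φ 0) / F b) ≤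
        (F' a) ^ 2 * Ψ' (F a) * (max (a - b) 0) ^ 2 +
          (F' b) ^ 2 * Ψ' (F b) * (max (b - a) 0) ^ 2 := by
    intro a b hab
    rw [max_eq_left (sub_nonneg.2 hab.le), max_eq_right (sub_nonpos.2 hab.le)]
    have h1 := sub_le_mul_of_convexOn_of_hasDerivAt hFconv (hFdiff a) hab
    have h2 := sub_le_mul_of_convexOn_of_hasDerivAt hΨF
      ((hΨdiff (F a) (hFpos a)).comp a (hFdiff a)) hab
    have h3 : 0 ≤ F a - F b := sub_nonneg.2 (hFmono hab.le)
    have h4 := hasDerivAt_nonneg_of_convexOn hconv hΨconc (hFpos a) (hΨdiff (F a) (hFpos a))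
    calc _ ≤ (F a - F b) * (Ψ' (F a) * F' a * (a - b)) := mul_le_mul_of_nonneg_left h2 h3
      _ = (F a - F b) * (Ψ' (F a) * (F' a * (a - b))) := by ring
      _ ≤ (F' a * (a - b)) * (Ψ' (F a) * (F' a * (a - b))) :=
        mul_le_mul_of_nonneg_right h1 (mul_nonneg h4 (h3.trans h1))
      _ = _ := by ring
  rcases lt_trichotomy a b with h | rfl | h
  · have := key b a h
    linarith
  · simp
  · exact key a b h

/-- Theorem (Φ-Sobolev inequality for composite functions): under the assumptions of
the SDPI → Φ-Sobolev theorem with `Ψ` differentiable, if `F : ℝ → (0,∞)` is convex,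
differentiable, nondecreasing, and `Ψ∘F` is convex, then for every `f : X → ℝ`,
`Ent_Φ[F∘f(X)] ≤ (1/(1−c)) E[F'(f(X))² Ψ'(F∘f(X)) ((f(X) − f(X'))₊)²]`, where
`(X,X')` is the exchangeable pair with law `μ ⊗ K*K`. -/
theorem statement13 {X Y : Type} [Fintype X] [Fintype Y] [Nonempty X] [Nonempty Y]
    (Φ Ψ' : ℝ → ℝ) (hconv : ConvexOn ℝ (Set.Ici 0) Φ)
    (hΨconc : ConcaveOn ℝ (Set.Ioi 0) (fun u => (Φ u - Φ 0) / u))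
    (hΨdiff : ∀ u ∈ Set.Ioi (0:ℝ), HasDerivAt (fun v => (Φ v - Φ 0) / v) (Ψ' u) u)
    (hhom : Homogeneous Φ)
    (μ : X → ℝ) (K : X → Y → ℝ) (hμ : IsPosDist μ) (hK : IsChannel K)
    (hadm : ∀ y, 0 < push μ K y)
    (c : ℝ) (hc : c < 1) (hη : eta Φ μ K ≤ c)
    (F F' : ℝ → ℝ) (hFpos : ∀ t, 0 < F t)
    (hFconv : ConvexOn ℝ Set.univ F)
    (hFdiff : ∀ t, HasDerivAt F (F' t) t)
    (hFmono : Monotone F)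
    (hΨF : ConvexOn ℝ Set.univ (fun t => (Φ (F t) - Φ 0) / F t))
    (f : X → ℝ) :
    Ent Φ μ (fun x => F (f x)) ≤ (1 / (1 - c)) *
      ∑ x, ∑ x', (μ x * ∑ y, K x y * adjoint μ K y x') *
        ((F' (f x)) ^ 2 * Ψ' (F (f x)) * (max (f x - f x') 0) ^ 2) := by
  set T : X → X → ℝ := fun x x' =>
    (F' (f x)) ^ 2 * Ψ' (F (f x)) * (max (f x - f x') 0) ^ 2
  have hg : ∀ x, 0 < F (f x) := fun x => hFpos _
  have hlocal : ∀ y, Ent Φ (adjoint μ K y) (fun x => F (f x)) ≤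
      ∑ x, ∑ x', adjoint μ K y x * adjoint μ K y x' * T x x' := by
    intro y
    have hw := adjoint_isDist hμ hK hadm y
    have hbound : ∑ x, ∑ x', adjoint μ K y x * adjoint μ K y x' *
          ((F (f x) - F (f x')) *
            ((Φ (F (f x)) - Φ 0) / F (f x) - (Φ (F (f x')) - Φ 0) / F (f x'))) ≤
        ∑ x, ∑ x', adjoint μ K y x * adjoint μ K y x' * (T x x' + T x' x) :=
      Finset.sum_le_sum fun x _ => Finset.sum_le_sum fun x' _ =>
        mul_le_mul_of_nonneg_left (mul_increment_le hconv hΨconc hΨdiff hFpos hFconv hFdiff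
          hFmono hΨF _ _) (mul_nonneg (hw.1 x) (hw.1 x'))
    have hswap : ∑ x, ∑ x', adjoint μ K y x * adjoint μ K y x' * T x' x =
        ∑ x, ∑ x', adjoint μ K y x * adjoint μ K y x' * T x x' := by
      rw [Finset.sum_comm]
      exact Finset.sum_congr rfl fun x _ => Finset.sum_congr rfl fun x' _ => by ring
    simp only [mul_add, Finset.sum_add_distrib, hswap] at hbound
    linarith [two_mul_ent_le hΨconc hw hg]
  have hsum : ∑ y, push μ K y * ∑ x, ∑ x', adjoint μ K y x * adjoint μ K y x' * T x x' =
      ∑ x, ∑ x', (μ x * ∑ y, K x y * adjoint μ K y x') * T x x' := by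
    simp only [Finset.mul_sum, Finset.sum_mul, ← mul_assoc, push_mul_adjoint hadm]
    rw [Finset.sum_comm]
    exact Finset.sum_congr rfl fun x _ => Finset.sum_comm
  have hchain := ent_eq_ent_condExp_add hK hadm Φ (fun x => F (f x))
  have hcontr := ent_condExp_le_of_homogeneous hconv hhom hμ hK hadm hη (fun x => (hg x).le)
    (Finset.sum_pos (fun x _ => mul_pos (hμ.1 x) (hg x)) Finset.univ_nonempty)
  have hcond : ∑ y, push μ K y * Ent Φ (adjoint μ K y) (fun x => F (f x)) ≤
      ∑ x, ∑ x', (μ x * ∑ y, K x y * adjoint μ K y x') * T x x' := by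
    rw [← hsum]
    exact Finset.sum_le_sum fun y _ => mul_le_mul_of_nonneg_left (hlocal y) (hadm y).le
  rw [one_div, ← div_eq_inv_mul, le_div_iff₀ (sub_pos.2 hc)]
  linarith

end SDPI
end
end

section
/- Let μ be a strictly positive probability distribution on a finite set X with |X| ≥ 2, and let M be a channel from X to X that is reversible with respect to μ. Define the Poincaré constant λ̃(μ,M) = inf{ ℰ_{μ,M}(f,f)/Var[f(X)] : f : X → ℝ nonconstant }, where X ~ μ. If (μ,M) factors through a channel K from X to a finite set Y with (μ,K) admissible, then η_{χ²}(μ,K) = S(μ,K)² = 1 − λ̃(μ,M). In particular, S(μ,K)² takes the same value for every channel K through which (μ,M) factors. -/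
open Finset

noncomputable section

namespace SDPI

variable {X Y : Type} [Fintype X] [Fintype Y]

/-- The second moment of the conditional expectation of `f(X)` given `Y`. -/
def condSecondMoment (μ : X → ℝ) (K : X → Y → ℝ) (f : X → ℝ) : ℝ :=
  ∑ y, (∑ x, μ x * K x y * f x) ^ 2 / push μ K y

/-- The contraction ratios `E[E[f(X)|Y]²] / E[f(X)²]` over nonzero centered `f`. -/
def contractionRatios (μ : X → ℝ) (K : X → Y → ℝ) : Set ℝ :=
  { r | ∃ f : X → ℝ, (∑ x, μ x * f x) = 0 ∧ f ≠ 0 ∧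
    r = condSecondMoment μ K f / ∑ x, μ x * f x ^ 2 }

lemma condSecondMoment_nonneg {μ : X → ℝ} {K : X → Y → ℝ} (hadm : ∀ y, 0 < push μ K y)
    (f : X → ℝ) : 0 ≤ condSecondMoment μ K f :=
  sum_nonneg fun y _ => div_nonneg (sq_nonneg _) (hadm y).le

lemma condSecondMoment_smul (μ : X → ℝ) (K : X → Y → ℝ) (c : ℝ) (f : X → ℝ) :
    condSecondMoment μ K (fun x => c * f x) = c ^ 2 * condSecondMoment μ K f := by
  unfold condSecondMoment
  rw [mul_sum]
  refine sum_congr rfl fun y _ => ?_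
  rw [← mul_div_assoc, ← mul_pow, mul_sum]
  congr 2
  exact sum_congr rfl fun x _ => by ring

lemma sum_mul_sq_smul (μ : X → ℝ) (c : ℝ) (f : X → ℝ) :
    ∑ x, μ x * (c * f x) ^ 2 = c ^ 2 * ∑ x, μ x * f x ^ 2 := by
  rw [mul_sum]
  exact sum_congr rfl fun x _ => by ring

lemma sum_mul_sq_pos {μ : X → ℝ} (hμ : IsPosDist μ) {f : X → ℝ} (hf : f ≠ 0) :
    0 < ∑ x, μ x * f x ^ 2 := by
  obtain ⟨x, hx⟩ := Function.ne_iff.mp hf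
  refine sum_pos' (fun z _ => mul_nonneg (hμ.1 z).le (sq_nonneg _)) ⟨x, mem_univ x, ?_⟩
  exact mul_pos (hμ.1 x) (sq_pos_of_ne_zero hx)

lemma sum_sum_mul_channel {K : X → Y → ℝ} (hK : IsChannel K) (h : X → ℝ) :
    ∑ y, ∑ x, h x * K x y = ∑ x, h x := by
  rw [sum_comm]
  exact sum_congr rfl fun x _ => by rw [← mul_sum, hK.2 x, mul_one]

lemma condSecondMoment_le {μ : X → ℝ} (hμ : IsPosDist μ) {K : X → Y → ℝ} (hK : IsChannel K)
    (hadm : ∀ y, 0 < push μ K y) (f : X → ℝ) :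
    condSecondMoment μ K f ≤ ∑ x, μ x * f x ^ 2 := by
  rw [← sum_sum_mul_channel hK]
  refine sum_le_sum fun y _ => ?_
  rw [div_le_iff₀ (hadm y), mul_comm]
  refine sum_sq_le_sum_mul_sum_of_sq_le_mul _
    (fun x _ => mul_nonneg (hμ.1 x).le (hK.1 x y))
    (fun x _ => mul_nonneg (mul_nonneg (hμ.1 x).le (sq_nonneg _)) (hK.1 x y))
    (fun x _ => le_of_eq (by ring))

lemma contractionRatios_nonneg {μ : X → ℝ} (hμ : IsPosDist μ) {K : X → Y → ℝ}
    (hadm : ∀ y, 0 < push μ K y) {r : ℝ} (hr : r ∈ contractionRatios μ K) : 0 ≤ r := by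
  obtain ⟨f, -, hf, rfl⟩ := hr
  exact div_nonneg (condSecondMoment_nonneg hadm f) (sum_mul_sq_pos hμ hf).le

lemma bddAbove_contractionRatios {μ : X → ℝ} (hμ : IsPosDist μ) {K : X → Y → ℝ}
    (hK : IsChannel K) (hadm : ∀ y, 0 < push μ K y) :
    BddAbove (contractionRatios μ K) := by
  refine ⟨1, ?_⟩
  rintro r ⟨f, -, hf, rfl⟩
  exact (div_le_one (sum_mul_sq_pos hμ hf)).2 (condSecondMoment_le hμ hK hadm f)

lemma sum_mul_sub_mean {μ : X → ℝ} (hμ : IsPosDist μ) (f : X → ℝ) :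
    ∑ x, μ x * (f x - ∑ x', μ x' * f x') = 0 := by
  simp only [mul_sub, sum_sub_distrib, ← sum_mul, hμ.2]
  ring

lemma contractionRatios_nonempty {μ : X → ℝ} (hμ : IsPosDist μ) (K : X → Y → ℝ)
    (hX : 2 ≤ Fintype.card X) : (contractionRatios μ K).Nonempty := by
  classical
  obtain ⟨a, b, hab⟩ := Fintype.exists_pair_of_one_lt_card hX
  set h : X → ℝ := fun x => if x = a then 1 else 0 with hh
  refine ⟨_, fun x => h x - ∑ x', μ x' * h x', sum_mul_sub_mean hμ h, ?_, rfl⟩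
  intro h0
  have ha := congrFun h0 a
  have hb := congrFun h0 b
  simp only [Pi.zero_apply] at ha hb
  have : h a = h b := by linarith
  simp [hh, hab.symm] at this

lemma fDiv_sq_eq (μ ν : X → ℝ) :
    fDiv (fun u => (u - 1) ^ 2) ν μ = ∑ x, μ x * (ν x / μ x - 1) ^ 2 := by
  simp [fDiv]

lemma fDiv_sq_push_eq {μ : X → ℝ} (hμ : ∀ x, 0 < μ x) {K : X → Y → ℝ}
    (hadm : ∀ y, 0 < push μ K y) (ν : X → ℝ) :
    fDiv (fun u => (u - 1) ^ 2) (push ν K) (push μ K) =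
      condSecondMoment μ K (fun x => ν x / μ x - 1) := by
  simp only [fDiv, condSecondMoment, sub_self, ne_eq, OfNat.ofNat_ne_zero, not_false_eq_true,
    zero_pow, sub_zero]
  refine sum_congr rfl fun y _ => ?_
  have h : ∑ x, μ x * K x y * (ν x / μ x - 1) = push ν K y - push μ K y := by
    simp only [push, ← sum_sub_distrib]
    refine sum_congr rfl fun x _ => ?_
    have := (hμ x).ne'
    field_simp
  rw [h]
  have := (hadm y).ne'
  field_simp

lemma exists_perturbation {μ : X → ℝ} (hμ : IsPosDist μ) {f : X → ℝ}
    (hf : ∑ x, μ x * f x = 0) :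
    ∃ c : ℝ, 0 < c ∧ IsDist fun x => μ x * (1 + c * f x) := by
  refine ⟨1 / (1 + ∑ x, |f x|), ?_, fun x => mul_nonneg (hμ.1 x).le ?_, ?_⟩
  · have : 0 ≤ ∑ x, |f x| := sum_nonneg fun _ _ => abs_nonneg _
    positivity
  · have h1 : |f x| ≤ ∑ x, |f x| :=
      single_le_sum (f := fun x => |f x|) (fun _ _ => abs_nonneg _) (mem_univ x)
    have h2 := neg_abs_le (f x)
    have h3 := abs_nonneg (f x)
    have h4 : 0 < 1 + ∑ x, |f x| := by linarith
    rw [div_mul_eq_mul_div, one_mul, ← neg_le_iff_add_nonneg', le_div_iff₀ h4]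
    linarith
  · have : ∀ c : ℝ, ∑ x, μ x * (1 + c * f x) = ∑ x, μ x + c * ∑ x, μ x * f x := fun c => by
      rw [mul_sum, ← sum_add_distrib]
      exact sum_congr rfl fun x _ => by ring
    rw [this, hf, hμ.2, mul_zero, add_zero]

theorem eta_sq_eq_sSup {μ : X → ℝ} (hμ : IsPosDist μ) {K : X → Y → ℝ}
    (hadm : ∀ y, 0 < push μ K y) :
    eta (fun u => (u - 1) ^ 2) μ K = sSup (contractionRatios μ K) := by
  unfold eta
  congr 1
  ext r
  constructor
  · rintro ⟨ν, hν, hne, rfl⟩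
    refine ⟨fun x => ν x / μ x - 1, ?_, ?_, ?_⟩
    · have : ∀ x, μ x * (ν x / μ x - 1) = ν x - μ x := fun x => by
        have := (hμ.1 x).ne'
        field_simp
      simp only [this, sum_sub_distrib, hν.2, hμ.2, sub_self]
    · intro h0
      refine hne (funext fun x => ?_)
      have h1 := congrFun h0 x
      simp only [Pi.zero_apply, sub_eq_zero] at h1
      exact (div_eq_one_iff_eq (hμ.1 x).ne').1 h1
    · rw [fDiv_sq_push_eq hμ.1 hadm, fDiv_sq_eq]
  · rintro ⟨f, hf, hne, rfl⟩
    obtain ⟨c, hc, hd⟩ := exists_perturbation hμ hf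
    have hq : ∀ x, μ x * (1 + c * f x) / μ x - 1 = c * f x := fun x => by
      rw [mul_div_cancel_left₀ _ (hμ.1 x).ne']
      ring
    refine ⟨_, hd, fun h0 => hne (funext fun x => ?_), ?_⟩
    · have h1 := hq x
      rw [congrFun h0 x, div_self (hμ.1 x).ne', sub_self] at h1
      exact (mul_eq_zero.1 h1.symm).resolve_left hc.ne'
    · rw [fDiv_sq_push_eq hμ.1 hadm, fDiv_sq_eq]
      simp only [hq]
      rw [condSecondMoment_smul, sum_mul_sq_smul, mul_div_mul_left _ _ (pow_pos hc 2).ne']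

lemma sum_sum_mul_eq (μ : X → ℝ) (K : X → Y → ℝ) (f : X → ℝ) (g : Y → ℝ) :
    ∑ x, ∑ y, μ x * K x y * (f x * g y) = ∑ y, (∑ x, μ x * K x y * f x) * g y := by
  rw [sum_comm]
  refine sum_congr rfl fun y _ => ?_
  rw [sum_mul]
  exact sum_congr rfl fun x _ => by ring

lemma sq_sum_sum_mul_le {μ : X → ℝ} {K : X → Y → ℝ} (hadm : ∀ y, 0 < push μ K y)
    (f : X → ℝ) (g : Y → ℝ) :
    (∑ x, ∑ y, μ x * K x y * (f x * g y)) ^ 2 ≤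
      condSecondMoment μ K f * ∑ y, push μ K y * g y ^ 2 := by
  rw [sum_sum_mul_eq]
  refine sum_sq_le_sum_mul_sum_of_sq_le_mul _
    (fun y _ => div_nonneg (sq_nonneg _) (hadm y).le)
    (fun y _ => mul_nonneg (hadm y).le (sq_nonneg _)) (fun y _ => le_of_eq ?_)
  have := (hadm y).ne'
  field_simp

theorem sq_maxCorr_eq_sSup {μ : X → ℝ} (hμ : IsPosDist μ) {K : X → Y → ℝ} (hK : IsChannel K)
    (hadm : ∀ y, 0 < push μ K y) (hX : 2 ≤ Fintype.card X) :
    maxCorr μ K ^ 2 = sSup (contractionRatios μ K) := by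
  have hbdd := bddAbove_contractionRatios hμ hK hadm
  have hnonneg : 0 ≤ sSup (contractionRatios μ K) :=
    Real.sSup_nonneg fun _ => contractionRatios_nonneg hμ hadm
  unfold maxCorr
  set S : Set ℝ := { r | ∃ (f : X → ℝ) (g : Y → ℝ),
    (∑ x, μ x * f x) = 0 ∧ (∑ y, push μ K y * g y) = 0 ∧
    (∑ x, μ x * (f x) ^ 2) = 1 ∧ (∑ y, push μ K y * (g y) ^ 2) = 1 ∧
    r = ∑ x, ∑ y, μ x * K x y * (f x * g y) }
  have hub : ∀ s ∈ S, s ≤ √(sSup (contractionRatios μ K)) := by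
    rintro s ⟨f, g, hf0, -, hf1, hg1, rfl⟩
    refine Real.le_sqrt_of_sq_le ((sq_sum_sum_mul_le hadm f g).trans ?_)
    rw [hg1, mul_one]
    refine le_csSup hbdd ⟨f, hf0, ?_, by rw [hf1, div_one]⟩
    rintro rfl
    simp at hf1
  have hneg : ∀ s ∈ S, -s ∈ S := by
    rintro s ⟨f, g, hf0, hg0, hf1, hg1, rfl⟩
    refine ⟨f, fun y => -g y, hf0, by simpa using hg0, hf1, by simpa using hg1, by simp⟩
  have hSbdd : BddAbove S := ⟨_, hub⟩
  have hS0 : 0 ≤ sSup S := by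
    rcases S.eq_empty_or_nonempty with h | ⟨s, hs⟩
    · simp [h]
    · have h1 := le_csSup hSbdd hs
      have h2 := le_csSup hSbdd (hneg s hs)
      linarith
  refine le_antisymm ?_ (csSup_le (contractionRatios_nonempty hμ K hX) ?_)
  · rw [← Real.le_sqrt hS0 hnonneg]
    exact Real.sSup_le hub (Real.sqrt_nonneg _)
  · rintro r ⟨f, hf0, hf, rfl⟩
    have hV := sum_mul_sq_pos hμ hf
    rcases (condSecondMoment_nonneg (K := K) hadm f).eq_or_lt with hQ | hQ
    · rw [← hQ, zero_div]
      exact sq_nonneg _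
    set Q := condSecondMoment μ K f
    set V := ∑ x, μ x * f x ^ 2
    let a : Y → ℝ := fun y => ∑ x, μ x * K x y * f x
    have hsQ : √Q ^ 2 = Q := Real.sq_sqrt hQ.le
    have hsV : √V ^ 2 = V := Real.sq_sqrt hV.le
    have hpQ : 0 < √Q := Real.sqrt_pos.2 hQ
    have hpV : 0 < √V := Real.sqrt_pos.2 hV
    have hmem : √Q / √V ∈ S := by
      refine ⟨fun x => (√V)⁻¹ * f x, fun y => (√Q)⁻¹ * (a y / push μ K y), ?_, ?_, ?_, ?_, ?_⟩
      · simp only [mul_left_comm (μ _) (√V)⁻¹, ← mul_sum, hf0, mul_zero]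
      · have h1 : ∀ y, push μ K y * ((√Q)⁻¹ * (a y / push μ K y)) = (√Q)⁻¹ * a y := fun y => by
          have := (hadm y).ne'
          field_simp
        have h2 : ∑ y, a y = 0 := by
          rw [← hf0, ← sum_sum_mul_channel hK]
          exact sum_congr rfl fun y _ => sum_congr rfl fun x _ => by ring
        simp only [h1, ← mul_sum, h2, mul_zero]
      · rw [sum_mul_sq_smul, inv_pow, hsV, inv_mul_cancel₀ hV.ne']
      · rw [sum_mul_sq_smul, inv_pow, hsQ]
        have : ∑ y, push μ K y * (a y / push μ K y) ^ 2 = Q := by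
          refine sum_congr rfl fun y _ => ?_
          have := (hadm y).ne'
          field_simp
          rfl
        rw [this, inv_mul_cancel₀ hQ.ne']
      · rw [sum_sum_mul_eq]
        have : ∀ y, (∑ x, μ x * K x y * ((√V)⁻¹ * f x)) * ((√Q)⁻¹ * (a y / push μ K y)) =
            (√V)⁻¹ * (√Q)⁻¹ * (a y ^ 2 / push μ K y) := fun y => by
          simp only [mul_left_comm _ (√V)⁻¹, ← mul_sum]
          change (√V)⁻¹ * a y * _ = _
          ring
        simp only [this, ← mul_sum]
        change _ = (√V)⁻¹ * (√Q)⁻¹ * Q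
        nth_rewrite 3 [← hsQ]
        field_simp
    have h := le_csSup hSbdd hmem
    calc Q / V = (√Q / √V) ^ 2 := by rw [div_pow, hsQ, hsV]
      _ ≤ sSup S ^ 2 := pow_le_pow_left₀ (by positivity) h 2

lemma dirichlet_self_eq {μ : X → ℝ} {M : X → X → ℝ} (hM : IsChannel M)
    (hrev : ∀ x x', μ x * M x x' = μ x' * M x' x) {K : X → Y → ℝ}
    (hfact : ∀ x x', M x x' = ∑ y, adjoint μ K y x' * K x y) (f : X → ℝ) :
    dirichlet μ M f f = ∑ x, μ x * f x ^ 2 - condSecondMoment μ K f := by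
  have h1 : ∑ x, ∑ x', μ x * M x x' * f x ^ 2 = ∑ x, μ x * f x ^ 2 := by
    refine sum_congr rfl fun x _ => ?_
    rw [← sum_mul, ← mul_sum, hM.2, mul_one]
  have h2 : ∑ x, ∑ x', μ x * M x x' * f x' ^ 2 = ∑ x, μ x * f x ^ 2 := by
    rw [sum_comm, ← h1]
    exact sum_congr rfl fun x _ => sum_congr rfl fun x' _ => by rw [hrev]
  have h3 : ∑ x, ∑ x', μ x * M x x' * (f x * f x') = condSecondMoment μ K f := by
    have hl : ∀ x x', μ x * M x x' * (f x * f x') =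
        ∑ y, μ x * K x y * f x * (μ x' * K x' y * f x') / push μ K y := fun x x' => by
      rw [hfact, mul_sum, sum_mul]
      refine sum_congr rfl fun y _ => ?_
      rw [adjoint]
      ring
    simp only [hl, condSecondMoment, sq, sum_mul_sum, sum_div]
    rw [sum_comm (s := (univ : Finset Y))]
    exact sum_congr rfl fun x _ => sum_comm
  rw [dirichlet]
  have : ∀ x x', μ x * M x x' * ((f x - f x') * (f x - f x')) =
      μ x * M x x' * f x ^ 2 + μ x * M x x' * f x' ^ 2 -
        2 * (μ x * M x x' * (f x * f x')) := fun x x' => by ring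
  simp only [this, sum_sub_distrib, sum_add_distrib, ← mul_sum, h1, h2, h3]
  ring

lemma dirichlet_sub_const (μ : X → ℝ) (M : X → X → ℝ) (f : X → ℝ) (c : ℝ) :
    dirichlet μ M (fun x => f x - c) (fun x => f x - c) = dirichlet μ M f f := by
  simp [dirichlet]

theorem sInf_dirichlet_div_var_eq {μ : X → ℝ} (hμ : IsPosDist μ) {M : X → X → ℝ}
    (hM : IsChannel M) (hrev : ∀ x x', μ x * M x x' = μ x' * M x' x) {K : X → Y → ℝ}
    (hK : IsChannel K) (hadm : ∀ y, 0 < push μ K y)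
    (hfact : ∀ x x', M x x' = ∑ y, adjoint μ K y x' * K x y) (hX : 2 ≤ Fintype.card X) :
    sInf { r | ∃ f : X → ℝ, (∃ x x', f x ≠ f x') ∧ r = dirichlet μ M f f / Var μ f } =
      1 - sSup (contractionRatios μ K) := by
  have hset : { r | ∃ f : X → ℝ, (∃ x x', f x ≠ f x') ∧ r = dirichlet μ M f f / Var μ f } =
      (fun r => 1 - r) '' contractionRatios μ K := by
    ext r
    constructor
    · rintro ⟨f, ⟨x, x', hne⟩, rfl⟩
      have h0 : (fun x => f x - ∑ x', μ x' * f x') ≠ 0 := fun h => by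
        have h1 := congrFun h x
        have h2 := congrFun h x'
        simp only [Pi.zero_apply] at h1 h2
        exact hne (by linarith)
      refine ⟨_, ⟨_, sum_mul_sub_mean hμ f, h0, rfl⟩, ?_⟩
      rw [← dirichlet_sub_const μ M f (∑ x', μ x' * f x'), dirichlet_self_eq hM hrev hfact,
        Var, sub_div, div_self (sum_mul_sq_pos hμ h0).ne']
    · rintro ⟨_, ⟨f, hf0, hf, rfl⟩, rfl⟩
      refine ⟨f, ?_, ?_⟩
      · by_contra! h
        refine hf (funext fun x => ?_)
        have h1 : ∑ z, μ z * f z = f x := by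
          simp only [fun z => h z x, ← sum_mul, hμ.2, one_mul]
        rw [← h1, hf0, Pi.zero_apply]
      · simp only [Var, hf0, sub_zero]
        rw [dirichlet_self_eq hM hrev hfact, sub_div, div_self (sum_mul_sq_pos hμ hf).ne']
  have hne := contractionRatios_nonempty hμ K hX
  have hlub := isLUB_csSup hne (bddAbove_contractionRatios hμ hK hadm)
  rw [hset]
  refine IsGLB.csInf_eq ⟨?_, fun b hb => ?_⟩ (hne.image _)
  · rintro _ ⟨r, hr, rfl⟩
    have := hlub.1 hr
    simpa only [sub_le_sub_iff_left] using this
  · have : sSup (contractionRatios μ K) ≤ 1 - b := csSup_le hne fun r hr => by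
      have := hb ⟨r, hr, rfl⟩
      simp only at this
      linarith
    linarith

/-- Theorem: if the reversible pair `(μ,M)` factors through a channel `K` (i.e.
`M = K*∘K`), then `η_{χ²}(μ,K) = S(μ,K)² = 1 − λ̃(μ,M)`, where
`λ̃(μ,M) = inf{ℰ_{μ,M}(f,f)/Var[f(X)] : f nonconstant}` is the Poincaré constant of
`(μ,M)`; in particular `S(μ,K)²` is the same for all such factorizations `K`. -/
theorem statement16 {X Y : Type} [Fintype X] [Fintype Y] [Nonempty X] [Nonempty Y]
    (hX : 2 ≤ Fintype.card X)
    (μ : X → ℝ) (hμ : IsPosDist μ)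
    (M : X → X → ℝ) (hM : IsChannel M)
    (hrev : ∀ x x', μ x * M x x' = μ x' * M x' x)
    (K : X → Y → ℝ) (hK : IsChannel K) (hadm : ∀ y, 0 < push μ K y)
    (hfact : ∀ x x', M x x' = ∑ y, adjoint μ K y x' * K x y) :
    eta (fun u => (u - 1) ^ 2) μ K = (maxCorr μ K) ^ 2 ∧
    (maxCorr μ K) ^ 2 =
      1 - sInf { r | ∃ f : X → ℝ, (∃ x x', f x ≠ f x') ∧
        r = dirichlet μ M f f / Var μ f } := by
  have hS := sq_maxCorr_eq_sSup hμ hK hadm hX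
  refine ⟨(eta_sq_eq_sSup hμ hadm).trans hS.symm, ?_⟩
  rw [hS, sInf_dirichlet_div_var_eq hμ hM hrev hK hadm hfact hX, sub_sub_cancel]

end SDPI
end
end
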